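/- On the negative-energy region, the scaled Laplace–Runge–Lenz components close into so(3)-type relations with the angular momentum: at every point (q,p) with qʲ ≠ 0 and pⱼ ≠ 0 for all j and H_α(q,p) < 0, setting Γᵢ = −Aᵅᵢ/√(−2mH_α), one has {Γ₁, Γ₂}_α = α²L′ᵅ₃, {Γ₂, Γ₃}_α = α²L′ᵅ₁, and {Γ₃, Γ₁}_α = α²L′ᵅ₂. -/

import Mathlib

noncomputable section

/-- The conformable power helper `|x|^(α-1) * x`. -/
def confPow (α x : ℝ) : ℝ := |x| ^ (α - 1) * x

/-- Partial derivative of `f : (q,p) ↦ ℝ` with respect to the coordinate `qⁱ`. -/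
def pdq (f : (Fin 3 → ℝ) → (Fin 3 → ℝ) → ℝ) (i : Fin 3) (q p : Fin 3 → ℝ) : ℝ :=
  deriv (fun t => f (Function.update q i t) p) (q i)

/-- Partial derivative of `f : (q,p) ↦ ℝ` with respect to the coordinate `pᵢ`. -/
def pdp (f : (Fin 3 → ℝ) → (Fin 3 → ℝ) → ℝ) (i : Fin 3) (q p : Fin 3 → ℝ) : ℝ :=
  deriv (fun t => f q (Function.update p i t)) (p i)

/-- The conformable Poisson bracket
`{f,g}_α = Σᵢ α⁻² |pᵢ|^{1-α} |qⁱ|^{1-α} (∂f/∂pᵢ ∂g/∂qⁱ - ∂f/∂qⁱ ∂g/∂pᵢ)`. -/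
def confPB (α : ℝ) (f g : (Fin 3 → ℝ) → (Fin 3 → ℝ) → ℝ) (q p : Fin 3 → ℝ) : ℝ :=
  ∑ i : Fin 3, (α ^ 2)⁻¹ * |p i| ^ (1 - α) * |q i| ^ (1 - α) *
    (pdp f i q p * pdq g i q p - pdq f i q p * pdp g i q p)

/-- The conformable radius `r_α = √(Σᵢ (α|qⁱ|^{α-1}qⁱ)²)`. -/
def rConf (α : ℝ) (q : Fin 3 → ℝ) : ℝ :=
  Real.sqrt (∑ i : Fin 3, (α * confPow α (q i)) ^ 2)

/-- The conformable Kepler Hamiltonian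
`H_α = Σᵢ (α|pᵢ|^{α-1}pᵢ)²/(2m) - k/r_α`. -/
def Hconf (α m k : ℝ) (q p : Fin 3 → ℝ) : ℝ :=
  (∑ i : Fin 3, (α * confPow α (p i)) ^ 2 / (2 * m)) - k / rConf α q

/-- The conformable angular momentum components (cyclic in the indices). -/
def Lconf (α : ℝ) (i : Fin 3) (q p : Fin 3 → ℝ) : ℝ :=
  α ^ 2 * (confPow α (q (i + 1)) * confPow α (p (i + 2)) -
           confPow α (q (i + 2)) * confPow α (p (i + 1)))

/-- The conformable Laplace–Runge–Lenz vector components (cyclic in the indices). -/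
def Aconf (α m k : ℝ) (i : Fin 3) (q p : Fin 3 → ℝ) : ℝ :=
  α * (confPow α (p (i + 1)) * Lconf α (i + 2) q p -
       confPow α (p (i + 2)) * Lconf α (i + 1) q p) -
  α * m * k / rConf α q * confPow α (q i)

/-- The scaled Laplace–Runge–Lenz vector on the negative-energy region:
`Γᵢ = -Aᵅᵢ/√(-2mH_α)`. -/
def GammaNeg (α m k : ℝ) (i : Fin 3) (q p : Fin 3 → ℝ) : ℝ :=
  -Aconf α m k i q p / Real.sqrt (-(2 * m * Hconf α m k q p))

/-- The scaled Laplace–Runge–Lenz vector on the positive-energy region: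
`Γ⁺ᵢ = -Aᵅᵢ/√(2mH_α)`. -/
def GammaPos (α m k : ℝ) (i : Fin 3) (q p : Fin 3 → ℝ) : ℝ :=
  -Aconf α m k i q p / Real.sqrt (2 * m * Hconf α m k q p)

/-- The Levi-Civita symbol `ε_{ijh} = (1/2)(i-j)(j-h)(h-i)`. -/
def levicivita (i j h : Fin 3) : ℝ :=
  ((i.1 : ℝ) - (j.1 : ℝ)) * ((j.1 : ℝ) - (h.1 : ℝ)) * ((h.1 : ℝ) - (i.1 : ℝ)) / 2

/-- Partial derivatives of the Laplace–Runge–Lenz component `i` in the position direction `j`. -/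
def lrlDerivPos (c r : ℝ) (x y : Fin 3 → ℝ) (i j : Fin 3) : ℝ :=
  (Pi.single j 1 : Fin 3 → ℝ) i * (∑ l, y l ^ 2) - y i * y j -
    c * ((Pi.single j 1 : Fin 3 → ℝ) i / r - x i * x j / r ^ 3)

/-- Partial derivatives of the Laplace–Runge–Lenz component `i` in the momentum direction `j`. -/
def lrlDerivMom (x y : Fin 3 → ℝ) (i j : Fin 3) : ℝ :=
  2 * x i * y j - (Pi.single j 1 : Fin 3 → ℝ) i * (∑ l, x l * y l) - y i * x j

/-- The Poisson bracket of the Laplace–Runge–Lenz vector with the Kepler Hamiltonian vanishes. -/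
lemma sum_lrlDeriv_hamiltonian {m k r : ℝ} (hm : m ≠ 0) (hr : r ≠ 0) (x y : Fin 3 → ℝ)
    (hx : r ^ 2 = ∑ l, x l ^ 2) (i : Fin 3) :
    ∑ j, (lrlDerivMom x y i j * (k * x j / r ^ 3) -
      lrlDerivPos (m * k) r x y i j * (y j / m)) = 0 := by
  simp only [Fin.sum_univ_three] at hx
  fin_cases i <;>
  · simp [lrlDerivPos, lrlDerivMom, Fin.sum_univ_three, Pi.single_apply]
    field_simp
    simp only [hx]
    ring

/-- The Poisson bracket of two Laplace–Runge–Lenz components. -/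
lemma sum_lrlDeriv_lrlDeriv {c r : ℝ} (hr : r ≠ 0) (x y : Fin 3 → ℝ)
    (hx : r ^ 2 = ∑ l, x l ^ 2) (i : Fin 3) :
    ∑ j, (lrlDerivMom x y i j * lrlDerivPos c r x y (i + 1) j -
      lrlDerivPos c r x y i j * lrlDerivMom x y (i + 1) j) =
    ((∑ l, y l ^ 2) - 2 * c / r) * (x i * y (i + 1) - x (i + 1) * y i) := by
  simp only [Fin.sum_univ_three] at hx
  fin_cases i <;>
  · simp [lrlDerivPos, lrlDerivMom, Fin.sum_univ_three, Pi.single_apply]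
    field_simp
    simp only [show r ^ 3 = r * r ^ 2 by ring, hx]
    ring

lemma hasDerivAt_confPow (α : ℝ) {x : ℝ} (hx : x ≠ 0) :
    HasDerivAt (confPow α) (α * |x| ^ (α - 1)) x := by
  have h := ((hasDerivAt_abs hx).rpow_const (p := α - 1)
    (Or.inl (abs_ne_zero.mpr hx))).mul (hasDerivAt_id x)
  refine h.congr_deriv ?_
  have hs : (SignType.sign x : ℝ) * x = |x| := by rw [sign_mul_self]
  have hr : |x| ^ (α - 1 - 1) * |x| = |x| ^ (α - 1) := by
    rw [← Real.rpow_add_one (abs_ne_zero.mpr hx)]; congr 1; ring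
  simp only [id]
  linear_combination (α - 1) * |x| ^ (α - 1 - 1) * hs + (α - 1) * hr

/-- Derivative of the conformable coordinates along a coordinate line. -/
lemma hasDerivAt_confPow_update (α : ℝ) (q : Fin 3 → ℝ) (j l : Fin 3) (hq : q j ≠ 0) :
    HasDerivAt (fun t => α * confPow α (Function.update q j t l))
      (α ^ 2 * |q j| ^ (α - 1) * (Pi.single j 1 : Fin 3 → ℝ) l) (q j) := by
  rcases eq_or_ne l j with rfl | h
  · simp only [Function.update_self, Pi.single_eq_same]
    exact ((hasDerivAt_confPow α hq).const_mul α).congr_deriv (by ring)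
  · simpa [Function.update_of_ne h, Pi.single_eq_of_ne h] using hasDerivAt_const (q j) _

lemma Aconf_eq (α m k : ℝ) (i : Fin 3) (q p : Fin 3 → ℝ) :
    Aconf α m k i q p = α * confPow α (q i) * (∑ l, (α * confPow α (p l)) ^ 2) -
      α * confPow α (p i) * (∑ l, α * confPow α (q l) * (α * confPow α (p l))) -
      m * k * (α * confPow α (q i) / rConf α q) := by
  fin_cases i <;> simp [Aconf, Lconf, Fin.sum_univ_three] <;> ring

lemma rConf_sq (α : ℝ) (q : Fin 3 → ℝ) :
    rConf α q ^ 2 = ∑ l, (α * confPow α (q l)) ^ 2 :=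
  Real.sq_sqrt (Finset.sum_nonneg fun _ _ => sq_nonneg _)

lemma rConf_pos {α : ℝ} (hα : α ≠ 0) {q : Fin 3 → ℝ} {j : Fin 3} (hq : q j ≠ 0) :
    0 < rConf α q := by
  have h : α * confPow α (q j) ≠ 0 :=
    mul_ne_zero hα (mul_ne_zero (Real.rpow_pos_of_pos (abs_pos.mpr hq) _).ne' hq)
  refine Real.sqrt_pos.mpr (Finset.sum_pos' (fun _ _ => sq_nonneg _) ⟨j, Finset.mem_univ j, ?_⟩)
  positivity

/-- Quotient rule for `-a / √(-(2 m h))`. -/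
lemma hasDerivAt_neg_div_sqrt {a h : ℝ → ℝ} {a' h' m t : ℝ} (ha : HasDerivAt a a' t)
    (hh : HasDerivAt h h' t) (hpos : 0 < -(2 * m * h t)) :
    HasDerivAt (fun u => -a u / √(-(2 * m * h u)))
      (-(a' / √(-(2 * m * h t)) + a t * m * h' / √(-(2 * m * h t)) ^ 3)) t := by
  have hs := (Real.sqrt_pos.mpr hpos).ne'
  refine (ha.neg.div ((hh.const_mul (2 * m)).neg.sqrt hpos.ne') hs).congr_deriv ?_
  simp only [Pi.neg_apply]
  field_simp
  ring

lemma hasDerivAt_rConf_update {α : ℝ} (hα : α ≠ 0) {q : Fin 3 → ℝ} {j : Fin 3} (hq : q j ≠ 0) :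
    HasDerivAt (fun t => rConf α (Function.update q j t))
      (α ^ 2 * |q j| ^ (α - 1) * (α * confPow α (q j) / rConf α q)) (q j) := by
  have hr := rConf_pos hα hq
  have h := HasDerivAt.fun_sum (u := Finset.univ)
    fun l _ => (hasDerivAt_confPow_update α q j l hq).fun_pow 2
  refine (h.sqrt ?_).congr_deriv ?_
  · simp only [Function.update_eq_self]
    rw [← rConf_sq]
    positivity
  · simp only [Function.update_eq_self, ← rConf_sq, Real.sqrt_sq hr.le]
    simp [Pi.single_apply]
    field_simp

lemma hasDerivAt_Hconf_pos {α : ℝ} (m k : ℝ) (hα : α ≠ 0) {q : Fin 3 → ℝ} (p : Fin 3 → ℝ)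
    {j : Fin 3} (hq : q j ≠ 0) :
    HasDerivAt (fun t => Hconf α m k (Function.update q j t) p)
      (α ^ 2 * |q j| ^ (α - 1) * (k * (α * confPow α (q j)) / rConf α q ^ 3)) (q j) := by
  have hr := (rConf_pos hα hq).ne'
  refine (((hasDerivAt_const (q j) k).div (hasDerivAt_rConf_update hα hq)
    (by simpa using hr)).const_sub _).congr_deriv ?_
  simp only [Function.update_eq_self]
  field_simp
  ring

lemma hasDerivAt_Hconf_mom {α m : ℝ} (k : ℝ) (hm : m ≠ 0) (q : Fin 3 → ℝ) {p : Fin 3 → ℝ}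
    {j : Fin 3} (hp : p j ≠ 0) :
    HasDerivAt (fun t => Hconf α m k q (Function.update p j t))
      (α ^ 2 * |p j| ^ (α - 1) * (α * confPow α (p j) / m)) (p j) := by
  refine ((HasDerivAt.fun_sum (u := Finset.univ) fun l _ =>
    ((hasDerivAt_confPow_update α p j l hp).fun_pow 2).div_const (2 * m)).sub_const
      _).congr_deriv ?_
  simp [Pi.single_apply, ← Finset.sum_div]
  field_simp

lemma hasDerivAt_Aconf_pos {α : ℝ} (m k : ℝ) (hα : α ≠ 0) {q : Fin 3 → ℝ} (p : Fin 3 → ℝ)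
    (i : Fin 3) {j : Fin 3} (hq : q j ≠ 0) :
    HasDerivAt (fun t => Aconf α m k i (Function.update q j t) p)
      (α ^ 2 * |q j| ^ (α - 1) * lrlDerivPos (m * k) (rConf α q) (fun l => α * confPow α (q l))
        (fun l => α * confPow α (p l)) i j) (q j) := by
  have hr := (rConf_pos hα hq).ne'
  have hx := fun l => hasDerivAt_confPow_update α q j l hq
  simp only [Aconf_eq]
  refine ((((hx i).mul_const _).sub ((HasDerivAt.fun_sum (u := Finset.univ) fun l _ =>
    (hx l).mul_const (α * confPow α (p l))).const_mul _)).sub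
      (((hx i).div (hasDerivAt_rConf_update hα hq) (by simpa using hr)).const_mul
        (m * k))).congr_deriv ?_
  simp only [Function.update_eq_self, lrlDerivPos]
  have hsum : ∑ l, α ^ 2 * |q j| ^ (α - 1) * (Pi.single j 1 : Fin 3 → ℝ) l *
      (α * confPow α (p l)) = α ^ 2 * |q j| ^ (α - 1) * (α * confPow α (p j)) := by
    simp [Pi.single_apply]
  rw [hsum]
  field_simp

lemma hasDerivAt_Aconf_mom (α m k : ℝ) (q : Fin 3 → ℝ) {p : Fin 3 → ℝ}
    (i : Fin 3) {j : Fin 3} (hp : p j ≠ 0) :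
    HasDerivAt (fun t => Aconf α m k i q (Function.update p j t))
      (α ^ 2 * |p j| ^ (α - 1) * lrlDerivMom (fun l => α * confPow α (q l))
        (fun l => α * confPow α (p l)) i j) (p j) := by
  have hy := fun l => hasDerivAt_confPow_update α p j l hp
  simp only [Aconf_eq]
  refine ((((HasDerivAt.fun_sum (u := Finset.univ) fun l _ =>
    (hy l).fun_pow 2).const_mul _).sub ((hy i).mul (HasDerivAt.fun_sum (u := Finset.univ) fun l _ =>
      (hy l).const_mul (α * confPow α (q l))))).sub_const _).congr_deriv ?_
  simp only [Function.update_eq_self, lrlDerivMom]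
  have hsum (f : Fin 3 → ℝ) : ∑ l, f l * (α ^ 2 * |p j| ^ (α - 1) *
      (Pi.single j 1 : Fin 3 → ℝ) l) = f j * (α ^ 2 * |p j| ^ (α - 1)) := by
    simp [Pi.single_apply]
  rw [hsum, hsum]
  push_cast
  ring

/-- The conformable weights cancel the factors produced by the chain rule. -/
lemma confPB_weight {α x y : ℝ} (hα : α ≠ 0) (hx : x ≠ 0) (hy : y ≠ 0) :
    (α ^ 2)⁻¹ * |y| ^ (1 - α) * |x| ^ (1 - α) *
      ((α ^ 2 * |y| ^ (α - 1)) * (α ^ 2 * |x| ^ (α - 1))) = α ^ 2 := by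
  have key {z : ℝ} (hz : z ≠ 0) : |z| ^ (1 - α) * |z| ^ (α - 1) = 1 := by
    rw [← Real.rpow_add (abs_pos.mpr hz)]; simp
  calc _ = (α ^ 2)⁻¹ * α ^ 2 * α ^ 2 * (|y| ^ (1 - α) * |y| ^ (α - 1)) *
        (|x| ^ (1 - α) * |x| ^ (α - 1)) := by ring
    _ = α ^ 2 := by rw [key hx, key hy]; field_simp

/-- The bracket of two consecutive scaled Laplace–Runge–Lenz components. -/
lemma confPB_GammaNeg_succ {α m k : ℝ} (hα : α ≠ 0) (hm : 0 < m) {q p : Fin 3 → ℝ}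
    (hq : ∀ j, q j ≠ 0) (hp : ∀ j, p j ≠ 0) (hH : Hconf α m k q p < 0) (i : Fin 3) :
    confPB α (GammaNeg α m k i) (GammaNeg α m k (i + 1)) q p =
      α ^ 2 * (-Lconf α (i + 2) q p) := by
  have hr := (rConf_pos hα (hq 0)).ne'
  have hpos : 0 < -(2 * m * Hconf α m k q p) := by nlinarith
  set x : Fin 3 → ℝ := fun l => α * confPow α (q l) with hx
  set y : Fin 3 → ℝ := fun l => α * confPow α (p l) with hy
  set r := rConf α q
  set s := √(-(2 * m * Hconf α m k q p)) with hs
  have hs0 : s ≠ 0 := (Real.sqrt_pos.mpr hpos).ne'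
  have hs2 : s ^ 2 = -((∑ l, y l ^ 2) - 2 * (m * k) / r) := by
    rw [hs, Real.sq_sqrt hpos.le]
    change -(2 * m * ((∑ l, y l ^ 2 / (2 * m)) - k / r)) = _
    rw [← Finset.sum_div]
    field_simp
  have dq (n j : Fin 3) : pdq (GammaNeg α m k n) j q p = α ^ 2 * |q j| ^ (α - 1) *
      -(lrlDerivPos (m * k) r x y n j / s +
        Aconf α m k n q p * m * (k * x j / r ^ 3) / s ^ 3) := by
    have h := hasDerivAt_neg_div_sqrt (m := m) (hasDerivAt_Aconf_pos m k hα p n (hq j))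
      (hasDerivAt_Hconf_pos m k hα p (hq j)) (by simpa using hpos)
    simp only [Function.update_eq_self] at h
    exact h.deriv.trans (by ring)
  have dp (n j : Fin 3) : pdp (GammaNeg α m k n) j q p = α ^ 2 * |p j| ^ (α - 1) *
      -(lrlDerivMom x y n j / s + Aconf α m k n q p * m * (y j / m) / s ^ 3) := by
    have h := hasDerivAt_neg_div_sqrt (m := m) (hasDerivAt_Aconf_mom α m k q n (hp j))
      (hasDerivAt_Hconf_mom k hm.ne' q (hp j)) (by simpa using hpos)
    simp only [Function.update_eq_self] at h
    exact h.deriv.trans (by ring)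
  have hL : Lconf α (i + 2) q p = x i * y (i + 1) - x (i + 1) * y i := by
    fin_cases i <;> simp [Lconf, hx, hy] <;> ring
  have hxr : r ^ 2 = ∑ l, x l ^ 2 := rConf_sq α q
  have h₀ := sum_lrlDeriv_hamiltonian (k := k) hm.ne' hr x y hxr i
  have h₁ := sum_lrlDeriv_hamiltonian (k := k) hm.ne' hr x y hxr (i + 1)
  have h₂ := sum_lrlDeriv_lrlDeriv (c := m * k) hr x y hxr i
  have hterm (j : Fin 3) : (α ^ 2)⁻¹ * |p j| ^ (1 - α) * |q j| ^ (1 - α) *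
      (pdp (GammaNeg α m k i) j q p * pdq (GammaNeg α m k (i + 1)) j q p -
        pdq (GammaNeg α m k i) j q p * pdp (GammaNeg α m k (i + 1)) j q p) =
      α ^ 2 / s ^ 2 * (lrlDerivMom x y i j * lrlDerivPos (m * k) r x y (i + 1) j -
        lrlDerivPos (m * k) r x y i j * lrlDerivMom x y (i + 1) j) +
      α ^ 2 * m * Aconf α m k (i + 1) q p / s ^ 4 *
        (lrlDerivMom x y i j * (k * x j / r ^ 3) -
          lrlDerivPos (m * k) r x y i j * (y j / m)) -
      α ^ 2 * m * Aconf α m k i q p / s ^ 4 *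
        (lrlDerivMom x y (i + 1) j * (k * x j / r ^ 3) -
          lrlDerivPos (m * k) r x y (i + 1) j * (y j / m)) := by
    rw [dq, dq, dp, dp]
    have hw := confPB_weight hα (hq j) (hp j)
    generalize y j / m = v
    generalize k * x j / r ^ 3 = u
    generalize lrlDerivMom x y i j = b₀
    generalize lrlDerivMom x y (i + 1) j = b₁
    generalize lrlDerivPos (m * k) r x y i j = a₀
    generalize lrlDerivPos (m * k) r x y (i + 1) j = a₁
    generalize Aconf α m k i q p = A₀
    generalize Aconf α m k (i + 1) q p = A₁
    linear_combination ((b₀ / s + A₀ * m * v / s ^ 3) * (a₁ / s + A₁ * m * u / s ^ 3) -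
      (a₀ / s + A₀ * m * u / s ^ 3) * (b₁ / s + A₁ * m * v / s ^ 3)) * hw
  simp only [confPB, hterm]
  rw [Finset.sum_sub_distrib, Finset.sum_add_distrib, ← Finset.mul_sum, ← Finset.mul_sum,
    ← Finset.mul_sum, h₀, h₁, h₂, hL, ← neg_eq_iff_eq_neg.mpr hs2]
  field_simp
  ring

/-- on the negative-energy region the scaled LRL components close
into `so(3)`-type relations with the angular momentum `L′ᵅᵢ = -Lᵅᵢ`. -/
theorem confPB_GammaNeg_so3
    (α m k : ℝ) (hα : 1 ≤ α) (hm : 0 < m)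
    (q p : Fin 3 → ℝ) (hq : ∀ j, q j ≠ 0) (hp : ∀ j, p j ≠ 0)
    (hH : Hconf α m k q p < 0) :
    confPB α (GammaNeg α m k 0) (GammaNeg α m k 1) q p
        = α ^ 2 * (-Lconf α 2 q p) ∧
    confPB α (GammaNeg α m k 1) (GammaNeg α m k 2) q p
        = α ^ 2 * (-Lconf α 0 q p) ∧
    confPB α (GammaNeg α m k 2) (GammaNeg α m k 0) q p
        = α ^ 2 * (-Lconf α 1 q p) := by
  have hα₀ : α ≠ 0 := by linarith
  exact ⟨confPB_GammaNeg_succ hα₀ hm hq hp hH 0, confPB_GammaNeg_succ hα₀ hm hq hp hH 1,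
    confPB_GammaNeg_succ hα₀ hm hq hp hH 2⟩
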